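/- For every integer n ≥ 1, every rank-n cylinder A, and every irrational x ∈ A, e^{−16}·λ(A) ≤ |DT^n(x)|^{−1} ≤ e^{16}·λ(A). -/

import Mathlib

open Filter MeasureTheory Set

/-- The Gauss map `T x = 1/x - ⌊1/x⌋`. -/
noncomputable def gaussMap (x : ℝ) : ℝ := Int.fract (1 / x)

/-- The `(i+1)`-st continued fraction digit `a_{i+1}(x) = ⌊1 / T^i x⌋`. -/
noncomputable def cfDigit (x : ℝ) (i : ℕ) : ℕ := ⌊1 / (gaussMap^[i] x)⌋₊

/-- Denominators of the convergents: `q_0 = 1`, `q_1 = a_1`, `q_n = a_n q_{n-1} + q_{n-2}`,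
given the digit sequence `a` (indexed so that `a i` is the `(i+1)`-st digit). -/
def contDen (a : ℕ → ℕ) : ℕ → ℕ
  | 0 => 1
  | 1 => a 0
  | (n + 2) => a (n + 1) * contDen a (n + 1) + contDen a n

/-- Numerators of the convergents: `p_0 = 0`, `p_1 = 1`, `p_n = a_n p_{n-1} + p_{n-2}`. -/
def contNum (a : ℕ → ℕ) : ℕ → ℕ
  | 0 => 0
  | 1 => 1
  | (n + 2) => a (n + 1) * contNum a (n + 1) + contNum a n

/-- `q_n(x)`, the denominator of the `n`-th convergent of `x`. -/
noncomputable def qDen (n : ℕ) (x : ℝ) : ℕ := contDen (cfDigit x) n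

/-- The rank-`n` cylinder: irrationals in `(0,1)` whose first `n`
continued fraction digits are `a 0, …, a (n-1)`. -/
noncomputable def cylinder (n : ℕ) (a : ℕ → ℕ) : Set ℝ :=
  {x | x ∈ Set.Ioo (0 : ℝ) 1 ∧ Irrational x ∧ ∀ i < n, cfDigit x i = a i}

/-- `gaussMap` is differentiable at irrational points. -/
theorem hasDerivAt_gaussMap {y : ℝ} (hy : Irrational y) : HasDerivAt gaussMap (-(y ^ 2)⁻¹) y := by
  have hy0 : y ≠ 0 := hy.ne_zero
  have hlt : (⌊y⁻¹⌋ : ℝ) < y⁻¹ := lt_of_le_of_ne (Int.floor_le _) (hy.inv.ne_int _).symm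
  have hev : ∀ᶠ w in nhds y, w⁻¹ ∈ Ioo (⌊y⁻¹⌋ : ℝ) (⌊y⁻¹⌋ + 1) :=
    (continuousAt_inv₀ hy0).eventually_mem (Ioo_mem_nhds hlt (Int.lt_floor_add_one _))
  refine ((hasDerivAt_inv hy0).sub_const (⌊y⁻¹⌋ : ℝ)).congr_of_eventuallyEq ?_
  filter_upwards [hev] with w hw
  have hfl : ⌊w⁻¹⌋ = ⌊y⁻¹⌋ := Int.floor_eq_iff.2 ⟨hw.1.le, hw.2⟩
  simp only [gaussMap, one_div, Int.fract, hfl]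

theorem mem_cylinder_succ {n : ℕ} {a : ℕ → ℕ} {x : ℝ} :
    x ∈ cylinder (n + 1) a ↔ x ∈ cylinder n a ∧ cfDigit x n = a n := by
  simp only [_root_.cylinder, mem_ofPred_eq, Nat.forall_lt_succ_right, and_assoc]

/-- For irrational `y ∈ (0,1)`, `y = 1 / (⌊1/y⌋ + T y)` and `T y` is again irrational in `(0,1)`. -/
theorem gaussMap_spec {y : ℝ} (hy : y ∈ Ioo (0 : ℝ) 1) (hi : Irrational y) :
    gaussMap y ∈ Ioo (0 : ℝ) 1 ∧ Irrational (gaussMap y) ∧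
      y = ((⌊1 / y⌋₊ : ℝ) + gaussMap y)⁻¹ := by
  have hirr : Irrational (gaussMap y) := by
    simp only [gaussMap, one_div, Int.fract]
    exact hi.inv.sub_intCast _
  refine ⟨⟨lt_of_le_of_ne (Int.fract_nonneg _) hirr.ne_zero.symm, Int.fract_lt_one _⟩, hirr, ?_⟩
  have hpos : 0 ≤ 1 / y := (one_div_pos.2 hy.1).le
  rw [gaussMap, natCast_floor_eq_intCast_floor hpos, Int.floor_add_fract, one_div, inv_inv]

/-- The point `1 / (k + z)` has first digit `k` and Gauss image `z`. -/
theorem inv_natCast_add_spec {k : ℕ} (hk : 1 ≤ k) {z : ℝ} (hz : z ∈ Ioo (0 : ℝ) 1)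
    (hi : Irrational z) :
    ((k : ℝ) + z)⁻¹ ∈ Ioo (0 : ℝ) 1 ∧ Irrational ((k : ℝ) + z)⁻¹ ∧
      ⌊1 / ((k : ℝ) + z)⁻¹⌋₊ = k ∧ gaussMap ((k : ℝ) + z)⁻¹ = z := by
  have hk' : (1 : ℝ) ≤ k := by exact_mod_cast hk
  have h0 := hz.1
  refine ⟨⟨by positivity, inv_lt_one_of_one_lt₀ (by linarith)⟩, (hi.natCast_add k).inv, ?_, ?_⟩
  · rw [one_div, inv_inv, Nat.floor_eq_iff (by positivity)]
    constructor <;> linarith [hz.2]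
  · rw [gaussMap, one_div, inv_inv, Int.fract_natCast_add, Int.fract_eq_self.2 ⟨h0.le, hz.2⟩]

/-- The inverse branch of `gaussMap^[n]` on a rank-`n` cylinder is a Möbius map
`y ↦ (p + p' y) / (q + q' y)` of determinant `±1` with `0 ≤ q' ≤ q` and `0 < q`. -/
theorem exists_moebius_inverse_branch (n : ℕ) (a : ℕ → ℕ) (ha : ∀ i < n, 1 ≤ a i) :
    ∃ p p' q q' : ℝ, 0 < q ∧ 0 ≤ q' ∧ q' ≤ q ∧ |p' * q - p * q'| = 1 ∧
      (∀ x ∈ cylinder n a, gaussMap^[n] x ∈ Ioo (0 : ℝ) 1 ∧ Irrational (gaussMap^[n] x) ∧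
        x = (p + p' * gaussMap^[n] x) / (q + q' * gaussMap^[n] x) ∧
        ∃ d, HasDerivAt (gaussMap^[n]) d x ∧ |d| = (q + q' * gaussMap^[n] x) ^ 2) ∧
      ∀ y ∈ Ioo (0 : ℝ) 1, Irrational y → (p + p' * y) / (q + q' * y) ∈ cylinder n a ∧
        gaussMap^[n] ((p + p' * y) / (q + q' * y)) = y := by
  induction n with
  | zero =>
    refine ⟨0, 1, 1, 0, one_pos, le_rfl, zero_le_one, by simp, ?_, ?_⟩
    · intro x hx
      exact ⟨hx.1, hx.2.1, by simp, 1, hasDerivAt_id x, by simp⟩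
    · intro y hy hi
      simp [_root_.cylinder, hi, hy.1, hy.2]
  | succ n ih =>
    obtain ⟨p, p', q, q', hq, hq', hle, hdet, hfwd, hbwd⟩ := ih fun i hi => ha i (by omega)
    have hk : 1 ≤ a n := ha n (by omega)
    have hk' : (1 : ℝ) ≤ a n := by exact_mod_cast hk
    have hmoeb : ∀ z : ℝ, 0 < z → (a n * p + p' + p * z) / (a n * q + q' + q * z) =
        (p + p' * (a n + z)⁻¹) / (q + q' * (a n + z)⁻¹) := by
      intro z hz
      have h1 : (a n : ℝ) + z ≠ 0 := by positivity
      have h2 : a n * q + q' + q * z ≠ 0 := by positivity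
      have h3 : q + q' * (a n + z)⁻¹ ≠ 0 := by positivity
      rw [div_eq_div_iff h2 h3]
      field_simp
      ring
    refine ⟨a n * p + p', p, a n * q + q', q, by positivity, hq.le, by nlinarith, ?_, ?_, ?_⟩
    · rw [← hdet, abs_sub_comm]
      congr 1
      ring
    · intro x hx
      obtain ⟨hxn, hdig⟩ := mem_cylinder_succ.1 hx
      obtain ⟨hy, hyi, hxy, d, hd, hdabs⟩ := hfwd x hxn
      obtain ⟨hz, hzi, hyz⟩ := gaussMap_spec hy hyi
      have hdig' : ⌊1 / gaussMap^[n] x⌋₊ = a n := hdig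
      rw [hdig'] at hyz
      have hz0 := hz.1
      rw [Function.iterate_succ_apply']
      refine ⟨hz, hzi, ?_, -((gaussMap^[n] x) ^ 2)⁻¹ * d, ?_, ?_⟩
      · rw [hmoeb _ hz.1, ← hyz]
        exact hxy
      · rw [Function.iterate_succ']
        exact (hasDerivAt_gaussMap hyi).comp x hd
      · rw [abs_mul, hdabs, abs_neg, abs_of_nonneg (by positivity)]
        generalize gaussMap (gaussMap^[n] x) = z at *
        rw [hyz]
        have h1 : (a n : ℝ) + z ≠ 0 := by positivity
        field_simp
        ring
    · intro z hz hzi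
      obtain ⟨hy, hyi, hdig, hT⟩ := inv_natCast_add_spec hk hz hzi
      obtain ⟨hmem, hinv⟩ := hbwd _ hy hyi
      rw [hmoeb z hz.1]
      refine ⟨mem_cylinder_succ.2 ⟨hmem, ?_⟩, ?_⟩
      · rw [cfDigit, hinv, hdig]
      · rw [Function.iterate_succ_apply', hinv, hT]

theorem measurableSet_irrational : MeasurableSet {y : ℝ | Irrational y} :=
  (countable_range ((↑) : ℚ → ℝ)).measurableSet.compl

theorem volume_Ioo_inter_irrational :
    volume (Ioo (0 : ℝ) 1 ∩ {y | Irrational y}) = 1 := by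
  have h : volume ({y : ℝ | Irrational y}ᶜ) = 0 := by
    have : {y : ℝ | Irrational y}ᶜ = range ((↑) : ℚ → ℝ) := compl_compl _
    rw [this]
    exact (countable_range _).measure_zero _
  rw [measure_inter_conull h]
  simp

/-- Measure of the image of a set under an injective map with derivative bounds. -/
theorem volume_image_mem_Icc {f f' : ℝ → ℝ} {s : Set ℝ} {c C : ℝ} (hs : MeasurableSet s)
    (hs1 : volume s = 1) (hf : ∀ y ∈ s, HasDerivAt f (f' y) y) (hinj : InjOn f s)
    (hc : ∀ y ∈ s, c ≤ |f' y|) (hC : ∀ y ∈ s, |f' y| ≤ C) (hC0 : 0 ≤ C) :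
    (volume (f '' s)).toReal ∈ Icc c C := by
  have himg := lintegral_image_eq_lintegral_abs_deriv_mul hs
    (fun y hy => (hf y hy).hasDerivWithinAt) hinj (fun _ => 1)
  simp only [setLIntegral_one, mul_one] at himg
  have hup : volume (f '' s) ≤ ENNReal.ofReal C := by
    rw [himg]
    calc _ ≤ ∫⁻ _ in s, ENNReal.ofReal C :=
          setLIntegral_mono measurable_const fun y hy => ENNReal.ofReal_le_ofReal (hC y hy)
      _ = _ := by rw [setLIntegral_const, hs1, mul_one]
  have hlow : ENNReal.ofReal c ≤ volume (f '' s) := by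
    rw [himg]
    calc _ = ∫⁻ _ in s, ENNReal.ofReal c := by rw [setLIntegral_const, hs1, mul_one]
      _ ≤ _ := setLIntegral_mono' hs fun y hy => ENNReal.ofReal_le_ofReal (hc y hy)
  exact ⟨(ENNReal.ofReal_le_iff_le_toReal (ne_top_of_le_ne_top ENNReal.ofReal_ne_top hup)).1 hlow,
    ENNReal.toReal_le_of_le_ofReal hC0 hup⟩

/-- For every `n ≥ 1`, every rank-`n` cylinder `A`, and every irrational `x ∈ A`,
`e^{-16} λ(A) ≤ |DT^n(x)|⁻¹ ≤ e^{16} λ(A)`. -/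
theorem deriv_inv_comparable_length (n : ℕ) (hn : 1 ≤ n) (a : ℕ → ℕ)
    (ha : ∀ i < n, 1 ≤ a i) (x : ℝ) (hx : x ∈ cylinder n a) :
    Real.exp (-16) * (volume (cylinder n a)).toReal ≤ |deriv (gaussMap^[n]) x|⁻¹ ∧
      |deriv (gaussMap^[n]) x|⁻¹ ≤ Real.exp 16 * (volume (cylinder n a)).toReal := by
  obtain ⟨p, p', q, q', hq, hq', hle, hdet, hfwd, hbwd⟩ := exists_moebius_inverse_branch n a ha
  have himg : (fun y => (p + p' * y) / (q + q' * y)) '' (Ioo (0 : ℝ) 1 ∩ {y | Irrational y}) =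
      cylinder n a := by
    refine Subset.antisymm ?_ fun w hw => ?_
    · rintro _ ⟨y, hy, rfl⟩
      exact (hbwd y hy.1 hy.2).1
    · obtain ⟨h1, h2, h3, -⟩ := hfwd w hw
      exact ⟨_, ⟨h1, h2⟩, h3.symm⟩
  have hbound : ∀ y ∈ Ioo (0 : ℝ) 1, q ^ 2 ≤ (q + q' * y) ^ 2 ∧ (q + q' * y) ^ 2 ≤ 4 * q ^ 2 := by
    intro y hy
    have h0 : 0 ≤ q' * y := mul_nonneg hq' hy.1.le
    have h1 : q' * y ≤ q := by nlinarith [hy.2]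
    constructor <;> nlinarith
  have hinv : ∀ y ∈ Ioo (0 : ℝ) 1,
      (4 * q ^ 2)⁻¹ ≤ ((q + q' * y) ^ 2)⁻¹ ∧ ((q + q' * y) ^ 2)⁻¹ ≤ (q ^ 2)⁻¹ := by
    intro y hy
    obtain ⟨h1, h2⟩ := hbound y hy
    have hq2 : 0 < q ^ 2 := by positivity
    exact ⟨inv_anti₀ (hq2.trans_le h1) h2, inv_anti₀ hq2 h1⟩
  have habs : ∀ y : ℝ, |(p' * q - p * q') / (q + q' * y) ^ 2| = ((q + q' * y) ^ 2)⁻¹ := by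
    intro y
    rw [abs_div, hdet, abs_of_nonneg (sq_nonneg _), one_div]
  have hvol : (volume (cylinder n a)).toReal ∈ Icc (4 * q ^ 2)⁻¹ (q ^ 2)⁻¹ := by
    rw [← himg]
    refine volume_image_mem_Icc (f' := fun y => (p' * q - p * q') / (q + q' * y) ^ 2)
      (measurableSet_Ioo.inter measurableSet_irrational)
      volume_Ioo_inter_irrational ?_ ?_ ?_ ?_ (by positivity)
    · intro y hy
      have hne : q + q' * y ≠ 0 := by
        have := hy.1.1
        positivity
      have hnum : HasDerivAt (fun y => p + p' * y) p' y := by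
        simpa using ((hasDerivAt_id y).const_mul p').const_add p
      have hden : HasDerivAt (fun y => q + q' * y) q' y := by
        simpa using ((hasDerivAt_id y).const_mul q').const_add q
      refine (hnum.div hden hne).congr_deriv ?_
      congr 1
      ring
    · intro y hy z hz hyz
      rw [← (hbwd y hy.1 hy.2).2, ← (hbwd z hz.1 hz.2).2]
      exact congrArg _ hyz
    · intro y hy
      rw [habs]
      exact (hinv y hy.1).1
    · intro y hy
      rw [habs]
      exact (hinv y hy.1).2
  obtain ⟨hy, -, -, d, hd, hdabs⟩ := hfwd x hx
  rw [hd.deriv, hdabs]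
  obtain ⟨hlo, hhi⟩ := hinv _ hy
  obtain ⟨hvlo, hvhi⟩ := hvol
  rw [mul_inv] at hlo hvlo
  have hexp : (4 : ℝ) ≤ Real.exp 16 := by linarith [Real.add_one_le_exp (16 : ℝ)]
  have hexp' : Real.exp (-16) ≤ 4⁻¹ := by
    rw [Real.exp_neg]
    exact inv_anti₀ (by norm_num) hexp
  have hv0 : 0 ≤ (volume (cylinder n a)).toReal := ENNReal.toReal_nonneg
  constructor <;> nlinarith
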